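/- In the implicit-function setup for η, assume u* is k-times continuously differentiable near 0 with sufficiently integrable Z_i. Then for every k ≥ 1, every θ in the neighborhood, and every j' = 1,…,d: Σ_{i=1}^{d} ((u*)^{(k)}_i(θ)) β_{i,j'} − (1/2) Σ_{q=0}^{k} C(k,q) ((u*)^{(k-q)}(θ))^T α^{j'} (u*)^{(q)}(θ) = Σ_{i=1}^{n} κ_{i,j'} Σ_{q=0}^{k} C(k,q) Σ_{(m_1,…,m_q) ∈ S_q} ( q! · E[ Z_i^{k-q} e^{θ Z_i} e^{u*(θ)^T γ_i Z_i} Π_{ℓ=1}^{q} ((u*)^{(ℓ)}(θ)^T γ_i Z_i)^{m_ℓ} ] ) / ( m_1! (1!)^{m_1} m_2! (2!)^{m_2} ⋯ m_q! (q!)^{m_q} ), where (u*)^{(0)} = u* and C(k,q) is the binomial coefficient. -/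

import Mathlib

open MeasureTheory Real Filter

/-- The index set `S_j` of Faà di Bruno's formula: the set of tuples `(m_1, …, m_j)` of
nonnegative integers with `1·m_1 + 2·m_2 + ⋯ + j·m_j = j` (here `m ℓ` is `m_{ℓ+1}`). -/
def faaDiBrunoS (j : ℕ) : Finset (Fin j → ℕ) :=
  ((Finset.univ : Finset (Fin j → Fin (j + 1))).image
      (fun (m : Fin j → Fin (j + 1)) (ℓ : Fin j) => (m ℓ : ℕ))).filter
    fun m => (∑ ℓ : Fin j, ((ℓ : ℕ) + 1) * m ℓ) = j

/-- uniform index set -/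
def fdbT (N q : ℕ) : Finset (Fin N → ℕ) :=
  (Fintype.piFinset (fun _ : Fin N => Finset.range (q + 1))).filter
    fun m => (∑ ℓ : Fin N, ((ℓ : ℕ) + 1) * m ℓ) = q

lemma le_of_fdb_sum {N : ℕ} (m : Fin N → ℕ) (l : Fin N) :
    m l ≤ ∑ ℓ : Fin N, ((ℓ : ℕ) + 1) * m ℓ := by
  calc m l ≤ ((l : ℕ) + 1) * m l := by nlinarith [Nat.zero_le (m l * l)]
    _ ≤ _ := Finset.single_le_sum (f := fun ℓ : Fin N => ((ℓ : ℕ) + 1) * m ℓ)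
      (fun _ _ => Nat.zero_le _) (Finset.mem_univ l)

lemma mem_fdbT {N q : ℕ} (m : Fin N → ℕ) :
    m ∈ fdbT N q ↔ (∑ ℓ : Fin N, ((ℓ : ℕ) + 1) * m ℓ) = q := by
  simp only [fdbT, Finset.mem_filter, Fintype.mem_piFinset, Finset.mem_range, and_iff_right_iff_imp]
  intro h l
  have := le_of_fdb_sum m l
  omega

lemma mem_faaDiBrunoS {q : ℕ} (m : Fin q → ℕ) :
    m ∈ faaDiBrunoS q ↔ (∑ ℓ : Fin q, ((ℓ : ℕ) + 1) * m ℓ) = q := by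
  simp only [faaDiBrunoS, Finset.mem_filter, and_iff_right_iff_imp]
  intro h
  refine Finset.mem_image.2 ⟨fun l => ⟨m l, ?_⟩, Finset.mem_univ _, rfl⟩
  have := le_of_fdb_sum m l
  omega

lemma faaDiBrunoS_eq (q : ℕ) : faaDiBrunoS q = fdbT q q := by
  ext m; rw [mem_faaDiBrunoS, mem_fdbT]

/-- weight -/
noncomputable def fdbW (a : ℕ → ℝ) {N : ℕ} (m : Fin N → ℕ) : ℝ :=
  ∏ l : Fin N, a ((l : ℕ) + 1) ^ m l / (Nat.factorial (m l) : ℝ)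

/-- normalised partition sum -/
noncomputable def fdbB (a : ℕ → ℝ) (N q : ℕ) : ℝ := ∑ m ∈ fdbT N q, fdbW a m

lemma fdbB_succ (a : ℕ → ℝ) {N q : ℕ} (h : q ≤ N) : fdbB a (N + 1) q = fdbB a N q := by
  unfold fdbB
  symm
  refine Finset.sum_bij' (fun m _ => (Fin.snoc m 0 : Fin (N + 1) → ℕ)) (fun m _ => Fin.init m)
    ?_ ?_ ?_ ?_ ?_
  · intro m hm
    rw [mem_fdbT] at hm ⊢
    simpa [Fin.sum_univ_castSucc] using hm
  · intro m hm
    rw [mem_fdbT] at hm ⊢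
    rw [Fin.sum_univ_castSucc] at hm
    have : m (Fin.last N) = 0 := by
      by_contra hne
      have : N + 1 ≤ ((Fin.last N : ℕ) + 1) * m (Fin.last N) := by
        simpa using Nat.le_mul_of_pos_right (N + 1) (Nat.pos_of_ne_zero hne)
      omega
    simpa [this, Fin.init] using hm
  · intro m hm; simp
  · intro m hm
    rw [mem_fdbT, Fin.sum_univ_castSucc] at hm
    have : m (Fin.last N) = 0 := by
      by_contra hne
      have : N + 1 ≤ ((Fin.last N : ℕ) + 1) * m (Fin.last N) := by
        simpa using Nat.le_mul_of_pos_right (N + 1) (Nat.pos_of_ne_zero hne)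
      omega
    conv_rhs => rw [← Fin.snoc_init_self m, this]
  · intro m hm
    simp [fdbW, Fin.prod_univ_castSucc]

lemma fdbB_eq (a : ℕ → ℝ) {N q : ℕ} (h : q ≤ N) : fdbB a N q = fdbB a q q := by
  induction N, h using Nat.le_induction with
  | base => rfl
  | succ N hN ih => rw [fdbB_succ a hN, ih]

lemma fdbW_split (a : ℕ → ℝ) {N : ℕ} (m : Fin N → ℕ) (l : Fin N) :
    fdbW a m = a ((l : ℕ) + 1) ^ m l / (Nat.factorial (m l) : ℝ) *
      ∏ x ∈ Finset.univ.erase l, a ((x : ℕ) + 1) ^ m x / (Nat.factorial (m x) : ℝ) :=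
  (Finset.mul_prod_erase Finset.univ _ (Finset.mem_univ l)).symm

lemma fdb_key (a : ℕ → ℝ) {N q : ℕ} (l : Fin N) (hl : (l : ℕ) ≤ q) :
    ∑ m ∈ fdbT N (q + 1), (m l : ℝ) * fdbW a m = a (l + 1) * fdbB a N (q - l) := by
  unfold fdbB
  rw [Finset.mul_sum]
  have h1 : ∑ m ∈ fdbT N (q + 1), (m l : ℝ) * fdbW a m
      = ∑ m ∈ (fdbT N (q + 1)).filter (fun m => m l ≠ 0), (m l : ℝ) * fdbW a m := by
    symm
    apply Finset.sum_filter_of_ne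
    intro m _ hne h0
    simp [h0] at hne
  rw [h1]
  symm
  have key : ∀ m : Fin N → ℕ, ∑ ℓ : Fin N, ((ℓ : ℕ) + 1) * (m + Pi.single l 1 : Fin N → ℕ) ℓ
      = (∑ ℓ : Fin N, ((ℓ : ℕ) + 1) * m ℓ) + (l + 1) := by
    intro m
    simp [mul_add, Finset.sum_add_distrib, Pi.single_apply]
  refine Finset.sum_bij' (fun m _ => m + Pi.single l 1) (fun m _ => m - Pi.single l 1)
    ?_ ?_ ?_ ?_ ?_
  · intro m hm
    rw [mem_fdbT] at hm
    rw [Finset.mem_filter, mem_fdbT, key]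
    refine ⟨by omega, by simp⟩
  · intro m hm
    rw [Finset.mem_filter, mem_fdbT] at hm
    rw [mem_fdbT]
    have : m = (m - Pi.single l 1) + Pi.single l 1 := by
      ext i
      by_cases hi : i = l
      · subst hi; simp; omega
      · simp [hi]
    have h2 := hm.1
    rw [this, key] at h2
    omega
  · intro m hm; ext i; simp
  · intro m hm
    rw [Finset.mem_filter] at hm
    ext i
    by_cases hi : i = l
    · subst hi; simp; omega
    · simp [hi]
  · intro m hm
    rw [fdbW_split a m l, fdbW_split a _ l]
    have : ∏ x ∈ Finset.univ.erase l, a ((x : ℕ) + 1) ^ (m + Pi.single l 1 : Fin N → ℕ) x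
        / (Nat.factorial ((m + Pi.single l 1 : Fin N → ℕ) x) : ℝ)
        = ∏ x ∈ Finset.univ.erase l, a ((x : ℕ) + 1) ^ m x / (Nat.factorial (m x) : ℝ) := by
      refine Finset.prod_congr rfl fun x hx => ?_
      have := Finset.ne_of_mem_erase hx
      simp [this]
    rw [this, ← mul_assoc, ← mul_assoc]
    congr 1
    simp only [Pi.add_apply, Pi.single_eq_same, Nat.factorial_succ]
    have h0 : (Nat.factorial (m l) : ℝ) ≠ 0 := by positivity
    push_cast
    field_simp
    ring

lemma fdbB_rec (a : ℕ → ℝ) (q : ℕ) :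
    ((q : ℝ) + 1) * fdbB a (q + 1) (q + 1)
      = ∑ i ∈ Finset.range (q + 1), ((i : ℝ) + 1) * a (i + 1) * fdbB a (q - i) (q - i) := by
  rw [Finset.sum_range]
  have : ((q : ℝ) + 1) * fdbB a (q + 1) (q + 1) = ∑ l : Fin (q + 1), ((l : ℝ) + 1) *
      ∑ m ∈ fdbT (q + 1) (q + 1), (m l : ℝ) * fdbW a m := by
    simp only [Finset.mul_sum]
    rw [Finset.sum_comm, fdbB, Finset.mul_sum]
    refine Finset.sum_congr rfl fun m hm => ?_
    rw [mem_fdbT] at hm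
    simp only [← mul_assoc]
    rw [← Finset.sum_mul]
    congr 1
    exact_mod_cast hm.symm
  rw [this]
  refine Finset.sum_congr rfl fun l _ => ?_
  rw [fdb_key a l (by omega), fdbB_eq a (by omega)]
  ring

lemma fdbB_zero (a : ℕ → ℝ) : fdbB a 0 0 = 1 := by
  have : fdbT 0 0 = Finset.univ := by ext m; simp only [mem_fdbT]; simp; exact Subsingleton.elim _ _
  simp [fdbB, this, fdbW]

/-- power series with coefficients `b_q` -/
noncomputable def fdbP (a : ℕ → ℝ) : PowerSeries ℝ := PowerSeries.mk fun q => fdbB a q q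

lemma fdbP_deriv (a : ℕ → ℝ) : PowerSeries.derivative ℝ (fdbP a)
    = PowerSeries.mk (fun i => ((i : ℝ) + 1) * a (i + 1)) * fdbP a := by
  ext q
  rw [PowerSeries.coeff_mul, Finset.Nat.sum_antidiagonal_eq_sum_range_succ_mk]
  simp only [PowerSeries.coeff_derivative, fdbP, PowerSeries.coeff_mk]
  rw [mul_comm, fdbB_rec]

/-- normalised Leibniz sum -/
noncomputable def fdbV (a : ℕ → ℝ) (z : ℝ) (k : ℕ) : ℝ :=
  ∑ q ∈ Finset.range (k + 1), z ^ (k - q) / (Nat.factorial (k - q) : ℝ) * fdbB a q q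

lemma fdbV_rec (a : ℕ → ℝ) (z : ℝ) (r : ℕ) :
    ((r : ℝ) + 1) * fdbV a z (r + 1)
      = ∑ i ∈ Finset.range (r + 1), ((if i = 0 then z else 0) + ((i : ℝ) + 1) * a (i + 1))
          * fdbV a z (r - i) := by
  set e : PowerSeries ℝ := PowerSeries.mk (fun k => z ^ k / (Nat.factorial k : ℝ)) with he
  have hV : ∀ k, fdbV a z k = PowerSeries.coeff k (fdbP a * e) := by
    intro k
    rw [PowerSeries.coeff_mul, Finset.Nat.sum_antidiagonal_eq_sum_range_succ_mk]
    simp only [fdbP, he, PowerSeries.coeff_mk, fdbV]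
    exact Finset.sum_congr rfl fun _ _ => mul_comm _ _
  have hde : PowerSeries.derivative ℝ e = PowerSeries.mk (fun i => if i = 0 then z else 0) * e := by
    have : (PowerSeries.mk (fun i => if i = 0 then z else 0) : PowerSeries ℝ) = PowerSeries.C z := by
      ext i; simp [PowerSeries.coeff_C]
    rw [this]
    ext q
    simp only [PowerSeries.coeff_derivative, PowerSeries.coeff_C_mul,
      he, PowerSeries.coeff_mk, Nat.factorial_succ]
    have h0 : (Nat.factorial q : ℝ) ≠ 0 := by positivity
    push_cast
    field_simp
    ring
  have hd : PowerSeries.derivative ℝ (fdbP a * e)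
      = PowerSeries.mk (fun i => (if i = 0 then z else 0) + ((i : ℝ) + 1) * a (i + 1))
        * (fdbP a * e) := by
    have : (PowerSeries.mk (fun i => (if i = 0 then z else 0) + ((i : ℝ) + 1) * a (i + 1)) :
        PowerSeries ℝ) = PowerSeries.mk (fun i => if i = 0 then z else 0)
          + PowerSeries.mk (fun i => ((i : ℝ) + 1) * a (i + 1)) := by
      ext i; simp
    rw [Derivation.leibniz, hde, fdbP_deriv, this]
    simp only [smul_eq_mul]
    ring
  have := congrArg (PowerSeries.coeff r) hd
  rw [PowerSeries.coeff_mul, Finset.Nat.sum_antidiagonal_eq_sum_range_succ_mk] at this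
  simp only [PowerSeries.coeff_derivative, PowerSeries.coeff_mk,
    ← hV] at this
  rw [mul_comm, this]

/-- The Leibniz--Faa di Bruno sum. -/
noncomputable def fdbL (x : ℕ → ℝ) (z : ℝ) (k : ℕ) : ℝ :=
  ∑ q ∈ Finset.range (k + 1), (Nat.choose k q : ℝ) * ∑ m ∈ faaDiBrunoS q,
    ((Nat.factorial q : ℝ) * (z ^ (k - q) * ∏ ℓ : Fin q, (x ((ℓ : ℕ) + 1) * z) ^ (m ℓ)))
      / ∏ ℓ : Fin q, (Nat.factorial (m ℓ) : ℝ) * (Nat.factorial ((ℓ : ℕ) + 1) : ℝ) ^ (m ℓ)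

lemma fdbL_eq (x : ℕ → ℝ) (z : ℝ) (k : ℕ) :
    fdbL x z k = (Nat.factorial k : ℝ) * fdbV (fun l => x l * z / (Nat.factorial l : ℝ)) z k := by
  unfold fdbL fdbV fdbB fdbW
  rw [Finset.mul_sum]
  refine Finset.sum_congr rfl fun q hq => ?_
  rw [faaDiBrunoS_eq, Finset.mul_sum, Finset.mul_sum, Finset.mul_sum]
  refine Finset.sum_congr rfl fun m hm => ?_
  have hq' : q ≤ k := by simpa [Nat.lt_succ_iff] using hq
  rw [Nat.cast_choose ℝ hq']
  have : ∏ l : Fin q, (x ((l : ℕ) + 1) * z / (Nat.factorial ((l : ℕ) + 1) : ℝ)) ^ m l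
      / (Nat.factorial (m l) : ℝ) = (∏ ℓ : Fin q, (x ((ℓ : ℕ) + 1) * z) ^ (m ℓ)) /
      ∏ ℓ : Fin q, (Nat.factorial (m ℓ) : ℝ) * (Nat.factorial ((ℓ : ℕ) + 1) : ℝ) ^ (m ℓ) := by
    rw [← Finset.prod_div_distrib]
    refine Finset.prod_congr rfl fun l _ => ?_
    rw [div_pow, div_div, mul_comm (Nat.factorial (m l) : ℝ)]
  rw [this]
  generalize ∏ ℓ : Fin q, (x ((ℓ : ℕ) + 1) * z) ^ (m ℓ) = Y
  have h0 : (Nat.factorial q : ℝ) ≠ 0 := by positivity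
  have h1 : (Nat.factorial (k - q) : ℝ) ≠ 0 := by positivity
  field_simp

lemma fdbL_zero (x : ℕ → ℝ) (z : ℝ) : fdbL x z 0 = 1 := by
  rw [fdbL_eq]; simp [fdbV, fdbB_zero]

lemma fdbL_rec (x : ℕ → ℝ) (z : ℝ) (r : ℕ) :
    fdbL x z (r + 1) = ∑ i ∈ Finset.range (r + 1), (Nat.choose r i : ℝ) *
      ((if i = 0 then 1 else 0) + x (i + 1)) * (z * fdbL x z (r - i)) := by
  rw [fdbL_eq, Nat.factorial_succ]
  push_cast
  rw [mul_comm ((r : ℝ) + 1), mul_assoc, fdbV_rec, Finset.mul_sum]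
  refine Finset.sum_congr rfl fun i hi => ?_
  have hi' : i ≤ r := by simpa [Nat.lt_succ_iff] using hi
  rw [Nat.cast_choose ℝ hi', fdbL_eq, Nat.factorial_succ]
  have h0 : (Nat.factorial i : ℝ) ≠ 0 := by positivity
  have h1 : (Nat.factorial (r - i) : ℝ) ≠ 0 := by positivity
  have h2 : ((i : ℝ) + 1) ≠ 0 := by positivity
  push_cast
  split_ifs with h
  · subst h; simp; field_simp
  · field_simp; ring

section analysis
variable {Ω : Type*} [MeasurableSpace Ω]

lemma fdb_exp_slope (z s t S : ℝ) (hz : 0 ≤ z) (hs : s ≤ S) (ht : t ≤ S) :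
    |Real.exp (t * z) - Real.exp (s * z)| ≤ |t - s| * (z * Real.exp (S * z)) := by
  have key : ∀ s t : ℝ, s ≤ t → t ≤ S →
      |Real.exp (t * z) - Real.exp (s * z)| ≤ |t - s| * (z * Real.exp (S * z)) := by
    intro s t hst ht
    have h1 : Real.exp (s * z) ≤ Real.exp (t * z) :=
      Real.exp_le_exp.2 (mul_le_mul_of_nonneg_right hst hz)
    have h2 : Real.exp (t * z) ≤ Real.exp (S * z) :=
      Real.exp_le_exp.2 (mul_le_mul_of_nonneg_right ht hz)
    rw [abs_of_nonneg (by linarith), abs_of_nonneg (by linarith)]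
    have h3 : Real.exp (s * z) = Real.exp (t * z) * Real.exp ((s - t) * z) := by
      rw [← Real.exp_add]; ring_nf
    have h4 := Real.add_one_le_exp ((s - t) * z)
    have h5 : 0 ≤ (t - s) * z := mul_nonneg (by linarith) hz
    have h6 := Real.exp_pos (t * z)
    calc Real.exp (t * z) - Real.exp (s * z)
        = Real.exp (t * z) * (1 - Real.exp ((s - t) * z)) := by rw [h3]; ring
      _ ≤ Real.exp (t * z) * ((t - s) * z) := by
          apply mul_le_mul_of_nonneg_left _ h6.le; linarith
      _ ≤ Real.exp (S * z) * ((t - s) * z) := mul_le_mul_of_nonneg_right h2 h5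
      _ = _ := by ring
  rcases le_total s t with h | h
  · exact key s t h ht
  · rw [abs_sub_comm, abs_sub_comm t s]; exact key t s h hs

lemma fdb_bound (T : Set ℝ) (s : ℝ) (hs : s ∈ T) :
    ∃ S ∈ T, s ≤ S ∧ ∀ᶠ t in nhdsWithin s T, t ≤ S := by
  by_cases h : ∃ S ∈ T, s < S
  · obtain ⟨S, hS, hsS⟩ := h
    refine ⟨S, hS, hsS.le, ?_⟩
    exact nhdsWithin_le_nhds (Filter.Eventually.mono (Iio_mem_nhds hsS) fun t ht => le_of_lt ht)
  · push Not at h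
    refine ⟨s, hs, le_rfl, ?_⟩
    exact Filter.Eventually.mono self_mem_nhdsWithin h

lemma fdb_contM (μ : Measure Ω) (Z : Ω → ℝ) (hZ : Measurable Z) (hZ0 : ∀ ω, 0 ≤ Z ω) (m : ℕ)
    (T : Set ℝ) (hT : ∀ s ∈ T, Integrable (fun ω => Z ω ^ m * Real.exp (s * Z ω)) μ) :
    ContinuousOn (fun s => ∫ ω, Z ω ^ m * Real.exp (s * Z ω) ∂μ) T := by
  intro s hs
  obtain ⟨S, hS, hsS, hev⟩ := fdb_bound T s hs
  refine tendsto_integral_filter_of_dominated_convergence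
    (fun ω => Z ω ^ m * Real.exp (S * Z ω)) ?_ ?_ (hT S hS) ?_
  · exact Eventually.of_forall fun t => by fun_prop
  · filter_upwards [hev] with t ht
    refine Eventually.of_forall fun ω => ?_
    have := hZ0 ω
    rw [Real.norm_of_nonneg (by positivity)]
    gcongr
  · refine Eventually.of_forall fun ω => ?_
    have : Continuous fun t : ℝ => Z ω ^ m * Real.exp (t * Z ω) := by fun_prop
    exact this.continuousWithinAt

lemma fdb_derivM (μ : Measure Ω) (Z : Ω → ℝ) (hZ : Measurable Z) (hZ0 : ∀ ω, 0 ≤ Z ω) (m : ℕ)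
    (T : Set ℝ) (hT : ∀ s ∈ T, Integrable (fun ω => Z ω ^ m * Real.exp (s * Z ω)) μ)
    (hT' : ∀ s ∈ T, Integrable (fun ω => Z ω ^ (m + 1) * Real.exp (s * Z ω)) μ)
    (s : ℝ) (hs : s ∈ T) :
    HasDerivWithinAt (fun s => ∫ ω, Z ω ^ m * Real.exp (s * Z ω) ∂μ)
      (∫ ω, Z ω ^ (m + 1) * Real.exp (s * Z ω) ∂μ) T s := by
  obtain ⟨S, hS, hsS, hev⟩ := fdb_bound T s hs
  rw [hasDerivWithinAt_iff_tendsto_slope]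
  have hsub : nhdsWithin s (T \ {s}) ≤ nhdsWithin s T := nhdsWithin_mono _ Set.sdiff_subset
  have hmain : Tendsto (fun t => ∫ ω, slope (fun s => Z ω ^ m * Real.exp (s * Z ω)) s t ∂μ)
      (nhdsWithin s (T \ {s})) (nhds (∫ ω, Z ω ^ (m + 1) * Real.exp (s * Z ω) ∂μ)) := by
    refine tendsto_integral_filter_of_dominated_convergence
      (fun ω => Z ω ^ (m + 1) * Real.exp (S * Z ω)) ?_ ?_ (hT' S hS) ?_
    · exact Eventually.of_forall fun t => by
        simp only [slope_def_field]; fun_prop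
    · filter_upwards [hsub hev, self_mem_nhdsWithin] with t ht hne
      have hne' : t - s ≠ 0 := sub_ne_zero.2 hne.2
      refine Eventually.of_forall fun ω => ?_
      have h0 := hZ0 ω
      rw [slope_def_field, ← mul_sub, norm_div, norm_mul, Real.norm_eq_abs, Real.norm_eq_abs,
        Real.norm_eq_abs, div_le_iff₀ (abs_pos.2 hne'), abs_of_nonneg (pow_nonneg h0 m)]
      have := mul_le_mul_of_nonneg_left (fdb_exp_slope (Z ω) s t S h0 hsS ht) (pow_nonneg h0 m)
      calc _ ≤ _ := this
        _ = _ := by ring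
    · refine Eventually.of_forall fun ω => ?_
      have : HasDerivAt (fun s => Z ω ^ m * Real.exp (s * Z ω))
          (Z ω ^ (m + 1) * Real.exp (s * Z ω)) s := by
        have h : HasDerivAt (fun s => Z ω ^ m * Real.exp (s * Z ω))
            (Z ω ^ m * (Real.exp (s * Z ω) * (1 * Z ω))) s :=
          (((hasDerivAt_id s).mul_const (Z ω)).exp).const_mul (Z ω ^ m)
        have heq : Z ω ^ (m + 1) * Real.exp (s * Z ω)
            = Z ω ^ m * (Real.exp (s * Z ω) * (1 * Z ω)) := by ring
        rw [heq]
        exact h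
      exact hasDerivWithinAt_iff_tendsto_slope.1 this.hasDerivWithinAt
  refine hmain.congr' ?_
  filter_upwards [self_mem_nhdsWithin] with t ht
  simp only [slope_def_field]
  rw [integral_div, integral_sub (hT t ht.1) (hT s hs)]

lemma fdbL_integrand_integrable (μ : Measure Ω) (Z : Ω → ℝ) (k : ℕ) (s : ℝ)
    (hint : ∀ m ≤ k, Integrable (fun ω => Z ω ^ m * Real.exp (s * Z ω)) μ)
    (x : ℕ → ℝ) (p q : ℕ) (hpq : p + q ≤ k) (m : Fin q → ℕ) (hm : m ∈ faaDiBrunoS q) :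
    Integrable (fun ω => (Z ω ^ p * Real.exp (s * Z ω)) *
      ∏ ℓ : Fin q, (x ((ℓ : ℕ) + 1) * Z ω) ^ (m ℓ)) μ := by
  rw [mem_faaDiBrunoS] at hm
  have hle : ∑ ℓ, m ℓ ≤ q := by
    conv_rhs => rw [← hm]
    exact Finset.sum_le_sum fun l _ => by nlinarith [Nat.zero_le (m l * l)]
  have := (hint (p + ∑ ℓ, m ℓ) (by omega)).const_mul (∏ ℓ : Fin q, x ((ℓ : ℕ) + 1) ^ (m ℓ))
  refine this.congr (Eventually.of_forall fun ω => ?_)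
  simp only [mul_pow, Finset.prod_mul_distrib, Finset.prod_pow_eq_pow_sum, pow_add]
  ring

lemma fdbL_integral (μ : Measure Ω) (Z : Ω → ℝ) (k : ℕ) (s : ℝ)
    (hint : ∀ m ≤ k, Integrable (fun ω => Z ω ^ m * Real.exp (s * Z ω)) μ)
    (x : ℕ → ℝ) (p r : ℕ) (hpr : p + r ≤ k) :
    Integrable (fun ω => Z ω ^ p * Real.exp (s * Z ω) * fdbL x (Z ω) r) μ ∧
    ∫ ω, Z ω ^ p * Real.exp (s * Z ω) * fdbL x (Z ω) r ∂μ =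
      ∑ q ∈ Finset.range (r + 1), (Nat.choose r q : ℝ) * ∑ m ∈ faaDiBrunoS q,
    ((Nat.factorial q : ℝ) * ∫ ω, (Z ω ^ (p + (r - q)) * Real.exp (s * Z ω)) *
        ∏ ℓ : Fin q, (x ((ℓ : ℕ) + 1) * Z ω) ^ (m ℓ) ∂μ)
      / ∏ ℓ : Fin q, (Nat.factorial (m ℓ) : ℝ) * (Nat.factorial ((ℓ : ℕ) + 1) : ℝ) ^ (m ℓ) := by
  have hfun : (fun ω => Z ω ^ p * Real.exp (s * Z ω) * fdbL x (Z ω) r) = fun ω =>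
      ∑ q ∈ Finset.range (r + 1), (Nat.choose r q : ℝ) * ∑ m ∈ faaDiBrunoS q,
    ((Nat.factorial q : ℝ) * ((Z ω ^ (p + (r - q)) * Real.exp (s * Z ω)) *
        ∏ ℓ : Fin q, (x ((ℓ : ℕ) + 1) * Z ω) ^ (m ℓ)))
      / ∏ ℓ : Fin q, (Nat.factorial (m ℓ) : ℝ) * (Nat.factorial ((ℓ : ℕ) + 1) : ℝ) ^ (m ℓ) := by
    funext ω
    unfold fdbL
    simp only [Finset.mul_sum]
    refine Finset.sum_congr rfl fun q _ => Finset.sum_congr rfl fun m _ => ?_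
    rw [pow_add]; ring
  have hI : ∀ q ∈ Finset.range (r + 1), ∀ m ∈ faaDiBrunoS q, Integrable (fun ω =>
      ((Nat.factorial q : ℝ) * ((Z ω ^ (p + (r - q)) * Real.exp (s * Z ω)) *
        ∏ ℓ : Fin q, (x ((ℓ : ℕ) + 1) * Z ω) ^ (m ℓ)))
      / ∏ ℓ : Fin q, (Nat.factorial (m ℓ) : ℝ) * (Nat.factorial ((ℓ : ℕ) + 1) : ℝ) ^ (m ℓ)) μ := by
    intro q hq m hm
    rw [Finset.mem_range] at hq
    exact ((fdbL_integrand_integrable μ Z k s hint x (p + (r - q)) q (by omega) m hm).const_mul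
      _).div_const _
  rw [hfun]
  refine ⟨integrable_finsetSum _ fun q hq => (integrable_finsetSum _ fun m hm =>
    hI q hq m hm).const_mul _, ?_⟩
  rw [integral_finsetSum _ fun q hq => (integrable_finsetSum _ fun m hm =>
    hI q hq m hm).const_mul _]
  refine Finset.sum_congr rfl fun q hq => ?_
  rw [integral_const_mul, integral_finsetSum _ fun m hm => hI q hq m hm]
  congr 1
  refine Finset.sum_congr rfl fun m hm => ?_
  rw [integral_div, integral_const_mul]

/-- The one-variable result. -/
lemma fdb_main (μ : Measure Ω) (Z : Ω → ℝ) (hZ : Measurable Z) (hZ0 : ∀ ω, 0 ≤ Z ω) (k : ℕ)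
    (U : Set ℝ) (hU : IsOpen U) (v : ℝ → ℝ) (hv : ContDiffOn ℝ k v U)
    (hint : ∀ m ≤ k, ∀ θ ∈ U,
      Integrable (fun ω => Z ω ^ m * Real.exp ((θ + v θ) * Z ω)) μ) :
    ∀ r m : ℕ, m + r ≤ k →
      ContDiffOn ℝ r (fun θ => ∫ ω, Z ω ^ m * Real.exp ((θ + v θ) * Z ω) ∂μ) U ∧
      ∀ θ ∈ U, iteratedDeriv r (fun θ => ∫ ω, Z ω ^ m * Real.exp ((θ + v θ) * Z ω) ∂μ) θ
        = ∫ ω, Z ω ^ m * Real.exp ((θ + v θ) * Z ω)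
            * fdbL (fun l => iteratedDeriv l v θ) (Z ω) r ∂μ := by
  set φ : ℝ → ℝ := fun θ => θ + v θ with hφ
  set f : ℕ → ℝ → ℝ := fun m θ => ∫ ω, Z ω ^ m * Real.exp ((θ + v θ) * Z ω) ∂μ with hf
  have hφs : ContDiffOn ℝ k φ U := contDiffOn_id.add hv
  have hTm : ∀ m ≤ k, ∀ s ∈ φ '' U, Integrable (fun ω => Z ω ^ m * Real.exp (s * Z ω)) μ := by
    rintro m hm s ⟨θ, hθ, rfl⟩
    exact hint m hm θ hθ
  have hcont : ∀ m ≤ k, ContinuousOn (f m) U := by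
    intro m hm
    exact (fdb_contM μ Z hZ hZ0 m _ (hTm m hm)).comp hφs.continuousOn (Set.mapsTo_image _ _)
  have hder : ∀ m, m + 1 ≤ k → ∀ θ ∈ U, HasDerivAt (f m) (deriv φ θ * f (m + 1) θ) θ := by
    intro m hm θ hθ
    have hd : DifferentiableAt ℝ φ θ :=
      (hφs.contDiffAt (hU.mem_nhds hθ)).differentiableAt (by
        have : k ≠ 0 := by omega
        exact_mod_cast this)
    have h1 := fdb_derivM μ Z hZ hZ0 m (φ '' U) (hTm m (by omega)) (hTm (m + 1) hm) (φ θ)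
      (Set.mem_image_of_mem _ hθ)
    have h2 := HasDerivWithinAt.comp θ h1 (hd.hasDerivAt.hasDerivWithinAt (s := U))
      (Set.mapsTo_image _ _)
    have h3 := h2.hasDerivAt (hU.mem_nhds hθ)
    rw [mul_comm]
    exact h3
  have hφd : ∀ r, r + 1 ≤ k → ContDiffOn ℝ r (deriv φ) U := by
    intro r hr
    have : ContDiffOn ℝ ((r : WithTop ℕ∞) + 1) φ U := hφs.of_le (by exact_mod_cast hr)
    exact ((contDiffOn_succ_iff_deriv_of_isOpen hU).1 this).2.2
  have hsm : ∀ r m : ℕ, m + r ≤ k → ContDiffOn ℝ r (f m) U := by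
    intro r
    induction r with
    | zero => intro m hm; simpa using hcont m (by omega)
    | succ r ih =>
      intro m hm
      have : ContDiffOn ℝ ((r : WithTop ℕ∞) + 1) (f m) U := by
        rw [contDiffOn_succ_iff_deriv_of_isOpen hU]
        refine ⟨fun θ hθ => (hder m (by omega) θ hθ).differentiableAt.differentiableWithinAt,
          fun h => by simp at h, ?_⟩
        exact ((hφd r (by omega)).mul (ih (m + 1) (by omega))).congr
          fun θ hθ => (hder m (by omega) θ hθ).deriv
      exact_mod_cast this
  have hφi : ∀ θ ∈ U, ∀ i, i + 1 ≤ k → iteratedDeriv i (deriv φ) θ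
      = (if i = 0 then 1 else 0) + iteratedDeriv (i + 1) v θ := by
    intro θ hθ i hi
    have hva : ContDiffAt ℝ ((i + 1 : ℕ)) v θ :=
      (hv.contDiffAt (hU.mem_nhds hθ)).of_le (by exact_mod_cast hi)
    have hid : ContDiffAt ℝ ((i + 1 : ℕ)) (fun x : ℝ => x) θ := contDiffAt_id
    rw [← iteratedDeriv_succ', hφ, iteratedDeriv_fun_add hid hva]
    congr 1
    rw [iteratedDeriv_succ']
    have : deriv (fun x : ℝ => x) = fun _ => 1 := by ext x; simp
    rw [this, iteratedDeriv_const]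
  refine fun r m hrm => ⟨hsm r m hrm, ?_⟩
  induction r using Nat.strong_induction_on generalizing m with
  | _ r ih =>
    intro θ hθ
    cases r with
    | zero => simp [fdbL_zero]
    | succ r =>
      have hev : deriv (f m) =ᶠ[nhds θ] fun t => deriv φ t * f (m + 1) t := by
        filter_upwards [hU.mem_nhds hθ] with t ht
        exact (hder m (by omega) t ht).deriv
      rw [iteratedDeriv_succ', hev.iteratedDeriv_eq,
        iteratedDeriv_fun_mul ((hφd r (by omega)).contDiffAt (hU.mem_nhds hθ))
          ((hsm r (m + 1) (by omega)).contDiffAt (hU.mem_nhds hθ))]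
      set x : ℕ → ℝ := fun l => iteratedDeriv l v θ with hx
      have hLI : ∀ i, Integrable (fun ω => Z ω ^ (m + 1) * Real.exp ((θ + v θ) * Z ω)
          * fdbL x (Z ω) (r - i)) μ := fun i =>
        (fdbL_integral μ Z k (θ + v θ) (fun m hm => hint m hm θ hθ) x (m + 1) (r - i)
          (by omega)).1
      have hR : (fun ω => Z ω ^ m * Real.exp ((θ + v θ) * Z ω) * fdbL x (Z ω) (r + 1))
          = fun ω => ∑ i ∈ Finset.range (r + 1), ((Nat.choose r i : ℝ) *
            ((if i = 0 then 1 else 0) + x (i + 1))) *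
            (Z ω ^ (m + 1) * Real.exp ((θ + v θ) * Z ω) * fdbL x (Z ω) (r - i)) := by
        funext ω
        rw [fdbL_rec, Finset.mul_sum]
        refine Finset.sum_congr rfl fun i _ => ?_
        ring
      rw [hR, integral_finsetSum _ fun i _ => (hLI i).const_mul _]
      refine Finset.sum_congr rfl fun i hi => ?_
      rw [Finset.mem_range] at hi
      rw [integral_const_mul, hφi θ hθ i (by omega),
        ih (r - i) (by omega) (m + 1) (by omega) θ hθ]

end analysis

/-- in the implicit-function setup for `η`, the `k`-times
differentiated defining equation for `u*`. -/
theorem implicit_ustar_kth_derivative_relation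
    (k : ℕ) (hk : 1 ≤ k)
    {Ω : Type*} [MeasurableSpace Ω] (μ : MeasureTheory.Measure Ω) [IsProbabilityMeasure μ]
    (n d : ℕ) (b : Fin d → ℝ) (β : Matrix (Fin d) (Fin d) ℝ)
    (α : Fin d → Matrix (Fin d) (Fin d) ℝ) (hα : ∀ j, (α j).IsSymm)
    (lam : Fin n → ℝ) (hlam : ∀ i, 0 ≤ lam i)
    (κ : Fin n → Fin d → ℝ) (γ : Fin n → Fin d → ℝ)
    -- nonnegative random variables with m.g.f. finite near `0`
    (Z : Fin n → Ω → ℝ) (hZmeas : ∀ i, Measurable (Z i)) (hZnn : ∀ i ω, 0 ≤ Z i ω)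
    (ε₀ : ℝ) (hε₀ : 0 < ε₀)
    (hZmgf : ∀ i, ∀ θ : ℝ, |θ| < ε₀ → Integrable (fun ω => Real.exp (θ * Z i ω)) μ)
    -- a neighborhood `U` of `0`
    (U : Set ℝ) (hUopen : IsOpen U) (hU0 : (0 : ℝ) ∈ U)
    -- the implicit function `u*`
    (ustar : ℝ → Fin d → ℝ) (hu0 : ustar 0 = 0)
    (husmooth : ContDiffOn ℝ (k : ℕ∞) ustar U)
    -- the relevant moments are finite
    (hZint : ∀ i : Fin n, ∀ m : ℕ, m ≤ k → ∀ θ ∈ U,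
      Integrable (fun ω => Z i ω ^ m
        * Real.exp ((θ + ∑ a, ustar θ a * γ i a) * Z i ω)) μ)
    -- the defining system of nonlinear equations for `u*`
    (heq : ∀ θ ∈ U, ∀ j : Fin d,
      (∑ i, ustar θ i * β i j)
        - (1/2) * (∑ i, ∑ i', ustar θ i * α j i i' * ustar θ i')
        - (∑ i : Fin n,
            ((∫ ω, Real.exp ((θ + ∑ a, ustar θ a * γ i a) * Z i ω) ∂μ) - 1) * κ i j) = 0)
    -- the definition of `η`
    (η : ℝ → ℝ)
    (hη : ∀ θ : ℝ, η θ = (∑ a, ustar θ a * b a)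
      + ∑ i : Fin n, lam i
          * ((∫ ω, Real.exp ((θ + ∑ a, ustar θ a * γ i a) * Z i ω) ∂μ) - 1))
 :
    ∀ θ ∈ U, ∀ j' : Fin d,
      (∑ i, iteratedDeriv k (fun θ' => ustar θ' i) θ * β i j')
        - (1/2) * (∑ q ∈ Finset.range (k + 1), (Nat.choose k q : ℝ) *
            ∑ i, ∑ i', iteratedDeriv (k - q) (fun θ' => ustar θ' i) θ * α j' i i'
              * iteratedDeriv q (fun θ' => ustar θ' i') θ)
      = ∑ i : Fin n, κ i j' *
          ∑ q ∈ Finset.range (k + 1), (Nat.choose k q : ℝ) *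
              ∑ m ∈ faaDiBrunoS q,
                ((Nat.factorial q : ℝ) *
                    ∫ ω, Z i ω ^ (k - q) * Real.exp (θ * Z i ω)
                      * Real.exp ((∑ a, ustar θ a * γ i a) * Z i ω)
                      * ∏ ℓ : Fin q,
                          ((∑ a, iteratedDeriv ((ℓ : ℕ) + 1) (fun θ' => ustar θ' a) θ
                              * γ i a) * Z i ω) ^ (m ℓ) ∂μ)
                  / ∏ ℓ : Fin q,
                      (Nat.factorial (m ℓ) : ℝ)
                        * (Nat.factorial ((ℓ : ℕ) + 1) : ℝ) ^ (m ℓ) := by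
  intro θ hθ j'
  have hcast : ContDiffOn ℝ k ustar U := by exact_mod_cast husmooth
  have hUn := hUopen.mem_nhds hθ
  have huc : ∀ a, ContDiffOn ℝ k (fun θ' => ustar θ' a) U := fun a =>
    (contDiffOn_pi.1 hcast) a
  have hua : ∀ a, ContDiffAt ℝ k (fun θ' => ustar θ' a) θ := fun a => (huc a).contDiffAt hUn
  have hv : ∀ i : Fin n, ContDiffOn ℝ k (fun θ' => ∑ a, ustar θ' a * γ i a) U := fun i =>
    ContDiffOn.sum fun a _ => (huc a).mul contDiffOn_const
  have hvd : ∀ i : Fin n, ∀ l ≤ k, iteratedDeriv l (fun θ' => ∑ a, ustar θ' a * γ i a) θ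
      = ∑ a, iteratedDeriv l (fun θ' => ustar θ' a) θ * γ i a := by
    intro i l hl
    have hla : ∀ a, ContDiffAt ℝ l (fun θ' => ustar θ' a * γ i a) θ := fun a =>
      ((hua a).mul contDiffAt_const).of_le (by exact_mod_cast hl)
    rw [iteratedDeriv_fun_sum fun a _ => hla a]
    refine Finset.sum_congr rfl fun a _ => ?_
    simp only [mul_comm _ (γ i a)]
    rw [iteratedDeriv_const_mul_field]
  have hmain := fun i : Fin n => fdb_main μ (Z i) (hZmeas i) (hZnn i) k U hUopen
    (fun θ' => ∑ a, ustar θ' a * γ i a) (hv i) (hZint i) k 0 (by omega)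
  simp only [pow_zero, one_mul] at hmain
  -- derivative of the moment generating part
  have hF : ∀ i : Fin n, iteratedDeriv k
      (fun θ' => ∫ ω, Real.exp ((θ' + ∑ a, ustar θ' a * γ i a) * Z i ω) ∂μ) θ =
      ∑ q ∈ Finset.range (k + 1), (Nat.choose k q : ℝ) *
              ∑ m ∈ faaDiBrunoS q,
                ((Nat.factorial q : ℝ) *
                    ∫ ω, Z i ω ^ (k - q) * Real.exp (θ * Z i ω)
                      * Real.exp ((∑ a, ustar θ a * γ i a) * Z i ω)
                      * ∏ ℓ : Fin q,
                          ((∑ a, iteratedDeriv ((ℓ : ℕ) + 1) (fun θ' => ustar θ' a) θ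
                              * γ i a) * Z i ω) ^ (m ℓ) ∂μ)
                  / ∏ ℓ : Fin q,
                      (Nat.factorial (m ℓ) : ℝ)
                        * (Nat.factorial ((ℓ : ℕ) + 1) : ℝ) ^ (m ℓ) := by
    intro i
    have h2 := (fdbL_integral μ (Z i) k (θ + ∑ a, ustar θ a * γ i a)
      (fun m hm => hZint i m hm θ hθ)
      (fun l => iteratedDeriv l (fun θ' => ∑ a, ustar θ' a * γ i a) θ) 0 k (by omega)).2
    simp only [pow_zero, one_mul, zero_add] at h2
    rw [(hmain i).2 θ hθ, h2]
    refine Finset.sum_congr rfl fun q hq => ?_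
    rw [Finset.mem_range] at hq
    congr 1
    refine Finset.sum_congr rfl fun m _ => ?_
    congr 2
    refine integral_congr_ae (Eventually.of_forall fun ω => ?_)
    simp only [add_mul, Real.exp_add, ← mul_assoc]
    congr 1
    refine Finset.prod_congr rfl fun ℓ _ => ?_
    rw [hvd i _ (by omega)]
  have hFc : ∀ i : Fin n, ContDiffAt ℝ k
      (fun θ' => ∫ ω, Real.exp ((θ' + ∑ a, ustar θ' a * γ i a) * Z i ω) ∂μ) θ := fun i =>
    (hmain i).1.contDiffAt hUn
  -- the differentiated equation
  have hz : iteratedDeriv k (fun θ' => (∑ i, ustar θ' i * β i j')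
        - (1/2) * (∑ i, ∑ i', ustar θ' i * α j' i i' * ustar θ' i')
        - (∑ i : Fin n,
            ((∫ ω, Real.exp ((θ' + ∑ a, ustar θ' a * γ i a) * Z i ω) ∂μ) - 1) * κ i j')) θ = 0 := by
    have hev : (fun θ' => (∑ i, ustar θ' i * β i j')
        - (1/2) * (∑ i, ∑ i', ustar θ' i * α j' i i' * ustar θ' i')
        - (∑ i : Fin n,
            ((∫ ω, Real.exp ((θ' + ∑ a, ustar θ' a * γ i a) * Z i ω) ∂μ) - 1) * κ i j'))
        =ᶠ[nhds θ] fun _ => 0 := by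
      filter_upwards [hUn] with t ht
      exact heq t ht j'
    rw [hev.iteratedDeriv_eq, iteratedDeriv_const]
    simp
  have c1 : ∀ i, ContDiffAt ℝ k (fun θ' => ustar θ' i * β i j') θ := fun i =>
    (hua i).mul contDiffAt_const
  have c2 : ∀ i i', ContDiffAt ℝ k (fun θ' => ustar θ' i * α j' i i' * ustar θ' i') θ :=
    fun i i' => ((hua i).mul contDiffAt_const).mul (hua i')
  have c2' : ∀ i, ContDiffAt ℝ k (fun θ' => ∑ i', ustar θ' i * α j' i i' * ustar θ' i') θ :=
    fun i => ContDiffAt.sum fun i' _ => c2 i i'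
  have c2'' : ContDiffAt ℝ k (fun θ' => ∑ i, ∑ i', ustar θ' i * α j' i i' * ustar θ' i') θ :=
    ContDiffAt.sum fun i _ => c2' i
  have c3 : ∀ i : Fin n, ContDiffAt ℝ k (fun θ' =>
      ((∫ ω, Real.exp ((θ' + ∑ a, ustar θ' a * γ i a) * Z i ω) ∂μ) - 1) * κ i j') θ := fun i =>
    ((hFc i).sub contDiffAt_const).mul contDiffAt_const
  have c1s : ContDiffAt ℝ k (fun θ' => ∑ i, ustar θ' i * β i j') θ :=
    ContDiffAt.sum fun i _ => c1 i
  have c2s : ContDiffAt ℝ k (fun θ' =>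
      (1/2 : ℝ) * ∑ i, ∑ i', ustar θ' i * α j' i i' * ustar θ' i') θ :=
    contDiffAt_const.mul c2''
  rw [iteratedDeriv_fun_sub (c1s.sub c2s) (ContDiffAt.sum fun i _ => c3 i),
    iteratedDeriv_fun_sub c1s c2s, iteratedDeriv_const_mul_field,
    iteratedDeriv_fun_sum fun i _ => c1 i, iteratedDeriv_fun_sum fun i _ => c2' i,
    iteratedDeriv_fun_sum fun i _ => c3 i] at hz
  have e1 : ∀ i, iteratedDeriv k (fun θ' => ustar θ' i * β i j') θ
      = iteratedDeriv k (fun θ' => ustar θ' i) θ * β i j' := by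
    intro i
    simp only [mul_comm _ (β i j')]
    rw [iteratedDeriv_const_mul_field]
  have e3 : ∀ i : Fin n, iteratedDeriv k (fun θ' =>
      ((∫ ω, Real.exp ((θ' + ∑ a, ustar θ' a * γ i a) * Z i ω) ∂μ) - 1) * κ i j') θ
      = κ i j' * iteratedDeriv k
      (fun θ' => ∫ ω, Real.exp ((θ' + ∑ a, ustar θ' a * γ i a) * Z i ω) ∂μ) θ := by
    intro i
    simp only [mul_comm _ (κ i j')]
    rw [iteratedDeriv_const_mul_field, iteratedDeriv_fun_sub (hFc i) contDiffAt_const,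
      iteratedDeriv_const, if_neg (by omega), sub_zero]
  have e2 : ∑ i, iteratedDeriv k (fun θ' => ∑ i', ustar θ' i * α j' i i' * ustar θ' i') θ
      = ∑ q ∈ Finset.range (k + 1), (Nat.choose k q : ℝ) *
            ∑ i, ∑ i', iteratedDeriv (k - q) (fun θ' => ustar θ' i) θ * α j' i i'
              * iteratedDeriv q (fun θ' => ustar θ' i') θ := by
    simp only [Finset.mul_sum]
    rw [Finset.sum_comm]
    refine Finset.sum_congr rfl fun i _ => ?_
    rw [Finset.sum_comm, iteratedDeriv_fun_sum fun i' _ => c2 i i']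
    refine Finset.sum_congr rfl fun i' _ => ?_
    have : (fun θ' => ustar θ' i * α j' i i' * ustar θ' i')
        = fun θ' => α j' i i' * (ustar θ' i' * ustar θ' i) := by
      funext t; ring
    rw [this, iteratedDeriv_const_mul_field, iteratedDeriv_fun_mul (hua i') (hua i),
      Finset.mul_sum]
    refine Finset.sum_congr rfl fun q _ => ?_
    ring
  simp only [e1, e2, e3, hF] at hz
  linarith [hz]
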